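/- Let ε ∈ (0, 1/32], δ ∈ (0,1), m ≥ 1, and B = log((m+1)/δ)/ε². Let L be a packing LP with n divisible by 4 and width at least 16B, and suppose K = 128·ε·B is a positive integer with K ≤ n. Let L_{<K} be obtained from L by setting to zero the values π_t of the K largest-valued items. Then the fraction of (n/4)-element subsets I ⊆ {1,…,n} for which OPT(L^I) ≥ OPT(L_{<K})/8 is at least 1 − 6δ, where L^I is the restricted packing LP with columns indexed by I and right-hand side (1/4)·b. -/

import Mathlib

open Finset
open scoped Classical

noncomputable section

/-- A packing LP `max ⟨π,x⟩ s.t. Ax ≤ b, x ∈ [0,1]^ι`, with columns indexed by `ι` and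
`m` packing constraints. -/
structure PLP (ι : Type) (m : ℕ) where
  pi : ι → ℝ
  A : ι → Fin m → ℝ
  b : Fin m → ℝ

namespace PLP

variable {ι : Type} [Fintype ι] {m : ℕ}

/-- `π ≥ 0`, all entries of `A` in `[0,1]`, `b > 0`. -/
def NonnegData (L : PLP ι m) : Prop :=
  (∀ t, 0 ≤ L.pi t) ∧ (∀ t i, L.A t i ∈ Set.Icc (0 : ℝ) 1) ∧ (∀ i, 0 < L.b i)

/-- feasibility for a packing LP. -/
def Feasible (L : PLP ι m) (x : ι → ℝ) : Prop :=
  (∀ t, x t ∈ Set.Icc (0 : ℝ) 1) ∧ ∀ i, ∑ t, L.A t i * x t ≤ L.b i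

/-- value of a solution. -/
def value (L : PLP ι m) (x : ι → ℝ) : ℝ := ∑ t, L.pi t * x t

/-- optimal value of a packing LP (`0 = sSup ∅` if infeasible). -/
def opt (L : PLP ι m) : ℝ := sSup {v : ℝ | ∃ x, L.Feasible x ∧ v = L.value x}

/-- the skimmed LP `skim_τ(L)`: the values of the high-value items `H = {t : π_t > τ}`
are set to zero, and the right-hand side becomes `b - Σ_{t∈H} A^t`. -/
def skim (L : PLP ι m) (τ : ℝ) : PLP ι m where
  pi := fun t => if τ < L.pi t then 0 else L.pi t
  A := L.A
  b := fun i => L.b i - ∑ t ∈ Finset.univ.filter (fun t => τ < L.pi t), L.A t i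

/-- `L_{<K}` style operation: set to zero the values of the items in `T`. -/
def zeroOn (L : PLP ι m) (T : Finset ι) : PLP ι m :=
  { L with pi := fun t => if t ∈ T then 0 else L.pi t }

/-- the restricted LP `L^I`: only the columns in `I` are kept and the right-hand side
is scaled by `|I| / |ι|`. -/
def restrict (L : PLP ι m) (I : Finset ι) : PLP {t // t ∈ I} m where
  pi := fun t => L.pi t
  A := fun t => L.A t
  b := fun i => ((I.card : ℝ) / (Fintype.card ι)) * L.b i

end PLP

/-- `τ` is a `Δ`-good skimming threshold for `L` (with parameters `ε` and `B`). -/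
def GoodSkim {ι : Type} [Fintype ι] {m : ℕ} (L : PLP ι m) (ε B τ Δ : ℝ) : Prop :=
  ((1 - ε) * L.opt ≤
      (L.skim τ).opt + ∑ t ∈ Finset.univ.filter (fun t => τ < L.pi t), L.pi t) ∧
  (∀ i, L.b i / 2 ≤ (L.skim τ).b i) ∧
  τ ≤ 24 * Δ / B

/-- fraction of the `binomial(|ι|,s)` subsets of size `s` satisfying `P`. -/
def subsetFrac (ι : Type) [Fintype ι] (s : ℕ) (P : Finset ι → Prop) : ℝ :=
  (Nat.card {I : Finset ι // I.card = s ∧ P I} : ℝ) /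
    (Nat.card {I : Finset ι // I.card = s} : ℝ)

lemma aux_choose (n s : ℕ) (hsn : s ≤ n) (k : ℕ) (hk : k ≤ s) :
    ((n - k).choose (s - k) : ℝ) * (n : ℝ) ^ k ≤ (n.choose s : ℝ) * (s : ℝ) ^ k := by
  induction k with
  | zero => simp
  | succ k ih =>
    have ih := ih (by omega)
    obtain ⟨a, ha⟩ : ∃ a, n - k = a + 1 := ⟨n - k - 1, by omega⟩
    obtain ⟨c, hc⟩ : ∃ c, s - k = c + 1 := ⟨s - k - 1, by omega⟩
    have h1 : n - (k + 1) = a := by omega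
    have h2 : s - (k + 1) = c := by omega
    rw [h1, h2]
    rw [ha, hc] at ih
    have h3 : ((a : ℝ) + 1) * (a.choose c) = ((a + 1).choose (c + 1)) * ((c : ℝ) + 1) := by
      exact_mod_cast Nat.add_one_mul_choose_eq a c
    have hn : (n : ℝ) = a + 1 + k := by
      have : n = a + 1 + k := by omega
      exact_mod_cast this
    have hs : (s : ℝ) = c + 1 + k := by
      have : s = c + 1 + k := by omega
      exact_mod_cast this
    have hca : (c : ℝ) ≤ a := by
      have : c ≤ a := by omega
      exact_mod_cast this
    have h4 : (a.choose c : ℝ) * n ≤ ((a + 1).choose (c + 1)) * s := by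
      have hp : (0 : ℝ) < a + 1 := by positivity
      have e : (a.choose c : ℝ) = ((a + 1).choose (c + 1)) * ((c : ℝ) + 1) / (a + 1) := by
        rw [eq_div_iff hp.ne', ← h3]; ring
      rw [e, div_mul_eq_mul_div, div_le_iff₀ hp, hn, hs, mul_assoc, mul_assoc]
      apply mul_le_mul_of_nonneg_left _ (by positivity)
      have : (0 : ℝ) ≤ k := by positivity
      nlinarith
    calc (a.choose c : ℝ) * (n : ℝ) ^ (k + 1) = (a.choose c : ℝ) * n * (n : ℝ) ^ k := by ring
      _ ≤ ((a + 1).choose (c + 1)) * s * (n : ℝ) ^ k := by gcongr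
      _ = s * (((a + 1).choose (c + 1)) * (n : ℝ) ^ k) := by ring
      _ ≤ s * ((n.choose s : ℝ) * (s : ℝ) ^ k) := by gcongr
      _ = _ := by ring

lemma aux_count {n : ℕ} (hn : 0 < n) (s : ℕ) (hsn : s ≤ n) (S : Finset (Fin n)) :
    ((((Finset.univ : Finset (Fin n)).powersetCard s).filter (fun I => S ⊆ I)).card : ℝ)
      ≤ (n.choose s : ℝ) * ((s : ℝ) / n) ^ S.card := by
  by_cases hk : S.card ≤ s
  · have h1 : (((Finset.univ : Finset (Fin n)).powersetCard s).filter (fun I => S ⊆ I)).card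
        ≤ ((Finset.univ \ S).powersetCard (s - S.card)).card := by
      apply Finset.card_le_card_of_injOn (fun I => I \ S)
      · intro I hI
        simp only [Finset.coe_filter, Finset.mem_powersetCard, Set.mem_ofPred_eq] at hI
        simp only [Finset.mem_coe, Finset.mem_powersetCard]
        refine ⟨Finset.sdiff_subset_sdiff (Finset.subset_univ _) le_rfl, ?_⟩
        rw [Finset.card_sdiff_of_subset hI.2, hI.1.2]
      · intro I hI J hJ h
        simp only [Finset.coe_filter, Finset.mem_powersetCard, Set.mem_ofPred_eq] at hI hJ
        have h' : I \ S = J \ S := h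
        rw [← Finset.sdiff_union_of_subset hI.2, ← Finset.sdiff_union_of_subset hJ.2, h']
    rw [Finset.card_powersetCard, Finset.card_sdiff_of_subset (Finset.subset_univ _),
      Finset.card_univ, Fintype.card_fin] at h1
    have h2 := aux_choose n s hsn S.card hk
    have hn' : (0 : ℝ) < (n : ℝ) ^ S.card := by positivity
    rw [div_pow, ← mul_div_assoc, le_div_iff₀ hn']
    refine le_trans ?_ h2
    have : ((((Finset.univ : Finset (Fin n)).powersetCard s).filter (fun I => S ⊆ I)).card : ℝ)
      ≤ ((n - S.card).choose (s - S.card) : ℝ) := by exact_mod_cast h1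
    gcongr
  · have : ((Finset.univ : Finset (Fin n)).powersetCard s).filter (fun I => S ⊆ I) = ∅ := by
      apply Finset.filter_eq_empty_iff.2
      intro I hI hS
      have := Finset.card_le_card hS
      rw [(Finset.mem_powersetCard.1 hI).2] at this
      exact hk this
    rw [this]
    simp only [Finset.card_empty, Nat.cast_zero]
    positivity

lemma aux_mgf {n : ℕ} (hn : 0 < n) (s : ℕ) (hsn : s ≤ n) (f : Fin n → ℝ) (hf : ∀ t, 0 ≤ f t) :
    ∑ I ∈ (Finset.univ : Finset (Fin n)).powersetCard s, ∏ t ∈ I, (1 + f t)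
      ≤ (n.choose s : ℝ) * Real.exp ((s : ℝ) / n * ∑ t, f t) := by
  have h1 : ∀ I : Finset (Fin n), ∏ t ∈ I, (1 + f t)
      = ∑ S : Finset (Fin n), if S ⊆ I then ∏ t ∈ S, f t else 0 := by
    intro I
    rw [Finset.prod_one_add, ← Finset.sum_filter]
    congr 1
    ext S; simp
  simp_rw [h1]
  rw [Finset.sum_comm]
  calc ∑ S : Finset (Fin n), ∑ I ∈ (Finset.univ : Finset (Fin n)).powersetCard s,
        (if S ⊆ I then ∏ t ∈ S, f t else 0)
      ≤ ∑ S : Finset (Fin n), (n.choose s : ℝ) * ∏ t ∈ S, ((s : ℝ) / n * f t) := by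
        apply Finset.sum_le_sum
        intro S _
        rw [← Finset.sum_filter, Finset.sum_const, nsmul_eq_mul, Finset.prod_mul_distrib,
          Finset.prod_const, ← mul_assoc]
        exact mul_le_mul_of_nonneg_right (aux_count hn s hsn S)
          (Finset.prod_nonneg fun t _ => hf t)
    _ = (n.choose s : ℝ) * ∏ t, (1 + (s : ℝ) / n * f t) := by
        rw [← Finset.mul_sum, Finset.prod_one_add, Finset.powerset_univ]
    _ ≤ _ := by
        rw [Finset.mul_sum, Real.exp_sum]
        apply mul_le_mul_of_nonneg_left _ (by positivity)
        apply Finset.prod_le_prod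
        · intro t _
          have := hf t
          positivity
        · intro t _
          linarith [Real.add_one_le_exp ((s : ℝ) / n * f t)]

lemma aux_tail {n : ℕ} (hn : 0 < n) (s : ℕ) (hsn : s ≤ n) (a : Fin n → ℝ)
    (ha : ∀ t, a t ∈ Set.Icc (0 : ℝ) 1) (μ l θ : ℝ) (hl0 : 0 ≤ l) (hl1 : l ≤ 1)
    (hμ : (s : ℝ) / n * ∑ t, a t ≤ μ) :
    ((((Finset.univ : Finset (Fin n)).powersetCard s).filter
      (fun I => θ < ∑ t ∈ I, a t)).card : ℝ)
      ≤ (n.choose s : ℝ) * Real.exp ((l + l ^ 2) * μ - l * θ) := by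
  have hexp : ∀ t, Real.exp (l * a t) ≤ 1 + (l + l ^ 2) * a t := by
    intro t
    obtain ⟨h0, h1⟩ := ha t
    have hla : l * a t ≤ 1 := by nlinarith
    have hla0 : 0 ≤ l * a t := by positivity
    have := Real.abs_exp_sub_one_sub_id_le (x := l * a t) (by rw [abs_of_nonneg hla0]; exact hla)
    have h2 := (abs_le.1 this).2
    have : a t ^ 2 ≤ a t := by nlinarith
    have : l ^ 2 * a t ^ 2 ≤ l ^ 2 * a t := by gcongr
    nlinarith
  have hmgf := aux_mgf hn s hsn (fun t => (l + l ^ 2) * a t)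
    (fun t => mul_nonneg (by positivity) (ha t).1)
  have hstep : ((((Finset.univ : Finset (Fin n)).powersetCard s).filter
      (fun I => θ < ∑ t ∈ I, a t)).card : ℝ) * Real.exp (l * θ)
      ≤ ∑ I ∈ (Finset.univ : Finset (Fin n)).powersetCard s, ∏ t ∈ I, (1 + (l + l ^ 2) * a t) := by
    rw [← nsmul_eq_mul, ← Finset.sum_const]
    refine le_trans (Finset.sum_le_sum (g := fun I => ∏ t ∈ I, (1 + (l + l ^ 2) * a t)) ?_)
      (Finset.sum_le_sum_of_subset_of_nonneg (Finset.filter_subset _ _) ?_)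
    · intro I hI
      have hI := (Finset.mem_filter.1 hI).2
      calc Real.exp (l * θ) ≤ Real.exp (l * ∑ t ∈ I, a t) := by
            apply Real.exp_le_exp.2; gcongr
        _ = ∏ t ∈ I, Real.exp (l * a t) := by rw [Finset.mul_sum, Real.exp_sum]
        _ ≤ _ := Finset.prod_le_prod (fun t _ => (Real.exp_pos _).le) (fun t _ => hexp t)
    · intro I _ _
      apply Finset.prod_nonneg
      intro t _
      have := (ha t).1
      positivity
  have : Real.exp ((l + l ^ 2) * μ - l * θ) = Real.exp ((l + l ^ 2) * μ) / Real.exp (l * θ) :=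
    Real.exp_sub _ _
  rw [this, ← mul_div_assoc, le_div_iff₀ (Real.exp_pos _)]
  refine hstep.trans (hmgf.trans ?_)
  apply mul_le_mul_of_nonneg_left _ (by positivity)
  apply Real.exp_le_exp.2
  rw [← Finset.mul_sum]
  calc (s : ℝ) / n * ((l + l ^ 2) * ∑ t, a t) = (l + l ^ 2) * ((s : ℝ) / n * ∑ t, a t) := by ring
    _ ≤ _ := by gcongr

/-- lower tail via complements. -/
lemma aux_lower {n q : ℕ} (hq : 0 < q) (hnq : n = 4 * q) (a : Fin n → ℝ)
    (ha : ∀ t, a t ∈ Set.Icc (0 : ℝ) 1) (ℓ : ℝ) (hM : 4096 * ℓ ≤ ∑ t, a t) (hℓ : 0 ≤ ℓ) :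
    ((((Finset.univ : Finset (Fin n)).powersetCard q).filter
      (fun I => ∑ t ∈ I, a t < 3 / 16 * ∑ t, a t)).card : ℝ)
      ≤ (n.choose q : ℝ) * Real.exp (-ℓ) := by
  have hn : 0 < n := by omega
  have hqn : (q : ℝ) ≠ 0 := by positivity
  have hratio : ((3 * q : ℕ) : ℝ) / n = 3 / 4 := by
    rw [hnq]; push_cast; field_simp
  have h := aux_tail hn (3 * q) (by omega) a ha (3 / 4 * ∑ t, a t) (1 / 24)
    (13 / 16 * ∑ t, a t) (by norm_num) (by norm_num) (by rw [hratio])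
  have hch : n.choose (3 * q) = n.choose q := by
    apply Nat.choose_symm_of_eq_add; omega
  rw [hch] at h
  refine le_trans ?_ (h.trans ?_)
  · norm_cast
    apply Finset.card_le_card_of_injOn (fun I => Iᶜ)
    · intro I hI
      simp only [Finset.coe_filter, Finset.mem_powersetCard, Set.mem_ofPred_eq] at hI ⊢
      refine ⟨⟨Finset.subset_univ _, ?_⟩, ?_⟩
      · rw [Finset.card_compl, hI.1.2, Fintype.card_fin]; omega
      · have := Finset.sum_add_sum_compl I a
        linarith [hI.2]
    · intro I _ J _ h
      exact compl_injective h
  · apply mul_le_mul_of_nonneg_left _ (by positivity)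
    apply Real.exp_le_exp.2
    linarith

lemma aux_upper {n q : ℕ} (hq : 0 < q) (hnq : n = 4 * q) (a : Fin n → ℝ)
    (ha : ∀ t, a t ∈ Set.Icc (0 : ℝ) 1) (ℓ b : ℝ) (hM : ∑ t, a t ≤ b) (hℓ : 64 * ℓ ≤ b) :
    ((((Finset.univ : Finset (Fin n)).powersetCard q).filter
      (fun I => 3 / 8 * b < ∑ t ∈ I, a t)).card : ℝ)
      ≤ (n.choose q : ℝ) * Real.exp (-ℓ) := by
  have hn : 0 < n := by omega
  have hqn : (q : ℝ) ≠ 0 := by positivity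
  have hratio : (q : ℝ) / n = 1 / 4 := by
    rw [hnq]; push_cast; field_simp
  refine (aux_tail hn q (by omega) a ha (b / 4) (1 / 4)
    (3 / 8 * b) (by norm_num) (by norm_num) (by rw [hratio]; linarith)).trans ?_
  apply mul_le_mul_of_nonneg_left _ (by positivity)
  apply Real.exp_le_exp.2
  linarith

lemma aux_frac {n q m : ℕ} (hqn : q ≤ n) (P Q : Finset (Fin n) → Prop)
    (R : Fin m → Finset (Fin n) → Prop) (δ : ℝ)
    (hQ : ((((Finset.univ : Finset (Fin n)).powersetCard q).filter Q).card : ℝ)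
      ≤ (n.choose q : ℝ) * (δ / (m + 1)))
    (hR : ∀ i, ((((Finset.univ : Finset (Fin n)).powersetCard q).filter (R i)).card : ℝ)
      ≤ (n.choose q : ℝ) * (δ / (m + 1)))
    (hP : ∀ I : Finset (Fin n), I.card = q → ¬ Q I → (∀ i, ¬ R i I) → P I) :
    1 - δ ≤ subsetFrac (Fin n) q P := by
  unfold subsetFrac
  set U := (Finset.univ : Finset (Fin n)).powersetCard q with hU
  have hUc : U.card = n.choose q := by rw [hU, Finset.card_powersetCard]; simp
  have e1 : Nat.card {I : Finset (Fin n) // I.card = q ∧ P I} = (U.filter P).card := by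
    rw [Nat.card_eq_fintype_card, Fintype.card_subtype]
    congr 1; ext I; simp [hU, Finset.mem_powersetCard]
  have e2 : Nat.card {I : Finset (Fin n) // I.card = q} = n.choose q := by
    rw [← hUc, Nat.card_eq_fintype_card, Fintype.card_subtype]
    congr 1; ext I; simp [hU, Finset.mem_powersetCard]
  rw [e1, e2]
  have hpos : (0 : ℝ) < n.choose q := by exact_mod_cast Nat.choose_pos hqn
  rw [le_div_iff₀ hpos]
  have hsub : U ⊆ U.filter P ∪ (U.filter Q ∪ Finset.univ.biUnion (fun i => U.filter (R i))) := by
    intro I hI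
    by_cases h1 : Q I
    · simp [hI, h1]
    by_cases h2 : ∃ i, R i I
    · obtain ⟨i, hi⟩ := h2
      simp only [Finset.mem_union, Finset.mem_filter, Finset.mem_biUnion]
      exact Or.inr (Or.inr ⟨i, Finset.mem_univ _, hI, hi⟩)
    · have := hP I (Finset.mem_powersetCard.1 hI).2 h1 (fun i hi => h2 ⟨i, hi⟩)
      simp [hI, this]
  have hc : U.card ≤ (U.filter P).card + ((U.filter Q).card + ∑ i, (U.filter (R i)).card) := by
    refine (Finset.card_le_card hsub).trans ((Finset.card_union_le _ _).trans ?_)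
    gcongr
    refine (Finset.card_union_le _ _).trans ?_
    gcongr
    exact Finset.card_biUnion_le
  rw [hUc] at hc
  have hc' : (n.choose q : ℝ) ≤ (U.filter P).card + ((U.filter Q).card
      + ∑ i, ((U.filter (R i)).card : ℝ)) := by exact_mod_cast hc
  have hs : ∑ i, ((U.filter (R i)).card : ℝ) ≤ m * ((n.choose q : ℝ) * (δ / (m + 1))) := by
    refine (Finset.sum_le_sum fun i _ => hR i).trans ?_
    simp
  have : (n.choose q : ℝ) * (δ / (m + 1)) + m * ((n.choose q : ℝ) * (δ / (m + 1)))
      = n.choose q * δ := by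
    have : (m : ℝ) + 1 ≠ 0 := by positivity
    field_simp
    ring
  linarith

lemma aux_bdd {ι : Type} [Fintype ι] {m : ℕ} (L : PLP ι m) (hpi : ∀ t, 0 ≤ L.pi t) :
    BddAbove {v : ℝ | ∃ x, L.Feasible x ∧ v = L.value x} := by
  refine ⟨∑ t, L.pi t, ?_⟩
  rintro v ⟨x, hx, rfl⟩
  apply Finset.sum_le_sum
  intro t _
  have := (hx.1 t).2
  nlinarith [hpi t]

lemma aux_le_opt {ι : Type} [Fintype ι] {m : ℕ} (L : PLP ι m) (hpi : ∀ t, 0 ≤ L.pi t)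
    (x : ι → ℝ) (hx : L.Feasible x) : L.value x ≤ L.opt :=
  le_csSup (aux_bdd L hpi) ⟨x, hx, rfl⟩

lemma aux_attain {ι : Type} [Fintype ι] {m : ℕ} (L : PLP ι m) (hb : ∀ i, 0 ≤ L.b i) :
    ∃ x, L.Feasible x ∧ L.opt = L.value x := by
  have hcomp : IsCompact {x : ι → ℝ | L.Feasible x} := by
    have h1 : IsCompact (Set.univ.pi (fun _ : ι => Set.Icc (0 : ℝ) 1)) :=
      isCompact_univ_pi fun _ => isCompact_Icc
    have h2 : IsClosed (⋂ i, {x : ι → ℝ | ∑ t, L.A t i * x t ≤ L.b i}) := by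
      apply isClosed_iInter
      intro i
      apply isClosed_le <;> fun_prop
    have := h1.inter_right h2
    convert this using 1
    ext x
    simp only [PLP.Feasible, Set.mem_inter_iff, Set.mem_iInter, Set.mem_univ_pi]
    rfl
  have hcont : Continuous L.value := by
    unfold PLP.value; fun_prop
  obtain ⟨x, hx, hmax⟩ := hcomp.exists_isMaxOn
    ⟨0, by simp [PLP.Feasible, hb]⟩ hcont.continuousOn
  refine ⟨x, hx, ?_⟩
  apply IsGreatest.csSup_eq
  refine ⟨⟨x, hx, rfl⟩, ?_⟩
  rintro v ⟨y, hy, rfl⟩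
  exact hmax hy

/-- lower bound for the restricted LP by a vector supported on the sample. -/
lemma aux_restrict {n q m : ℕ} (hq : 0 < q) (hnq : n = 4 * q) (L : PLP (Fin n) m)
    (hpi : ∀ t, 0 ≤ L.pi t) (I : Finset (Fin n)) (hI : I.card = q) (y : Fin n → ℝ)
    (hy : ∀ t, y t ∈ Set.Icc (0 : ℝ) 1) (hA : ∀ i, ∑ t ∈ I, L.A t i * y t ≤ L.b i / 4) :
    ∑ t ∈ I, L.pi t * y t ≤ (L.restrict I).opt := by
  have h := aux_le_opt (L.restrict I) (fun t => hpi t) (fun t => y t) ⟨fun t => hy t, ?_⟩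
  · refine le_trans (le_of_eq ?_) h
    exact (Finset.sum_coe_sort I (fun t => L.pi t * y t)).symm
  · intro i
    have e : (L.restrict I).b i = L.b i / 4 := by
      have : (q : ℝ) ≠ 0 := by positivity
      simp only [PLP.restrict, hI, Fintype.card_fin]
      have hn' : (n : ℝ) = 4 * q := by exact_mod_cast hnq
      rw [hn']; field_simp
    rw [e]
    refine le_trans (le_of_eq ?_) (hA i)
    exact Finset.sum_coe_sort I (fun t => L.A t i * y t)

/-- with probability at least `1 - 6δ` over a random `(n/4)`-subset
`I`, the sampled LP satisfies `OPT(L^I) ≥ OPT(L_{<K})/8`. -/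
theorem stmt16 {n m : ℕ} (hm : 1 ≤ m) (L : PLP (Fin n) m) (hL : L.NonnegData)
    (ε δ B : ℝ) (hε0 : 0 < ε) (hε1 : ε ≤ 1 / 32) (hδ0 : 0 < δ) (hδ1 : δ < 1)
    (hB : B = Real.log ((m + 1 : ℝ) / δ) / ε ^ 2)
    -- the width of `L` is at least `16B`:
    (hwidth : ∀ i, 16 * B ≤ L.b i)
    (hn4 : 4 ∣ n)
    -- `K = 128·ε·B` is a positive integer with `K ≤ n`:
    (K : ℕ) (hK1 : 1 ≤ K) (hKn : K ≤ n) (hK : (K : ℝ) = 128 * ε * B)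
    -- `T` is the set of the `K` largest-valued items, so that `L.zeroOn T = L_{<K}`:
    (T : Finset (Fin n)) (hTcard : T.card = K)
    (hTtop : ∀ t ∈ T, ∀ s ∉ T, L.pi s ≤ L.pi t) :
    1 - 6 * δ ≤ subsetFrac (Fin n) (n / 4)
      (fun I => (L.zeroOn T).opt / 8 ≤ (L.restrict I).opt) := by



  obtain ⟨q, hnq⟩ := hn4
  have hq : 0 < q := by omega
  have hn : 0 < n := by omega
  have hdiv : n / 4 = q := by omega
  rw [hdiv]
  obtain ⟨hpi, hA, hb⟩ := hL
  set ℓ := Real.log ((m + 1 : ℝ) / δ) with hℓdef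
  have hm1 : (0 : ℝ) < m + 1 := by positivity
  have hℓ0 : 0 < ℓ := by
    apply Real.log_pos
    rw [lt_div_iff₀ hδ0]
    have : (0 : ℝ) ≤ m := by positivity
    linarith
  have hexpℓ : Real.exp (-ℓ) = δ / (m + 1) := by
    rw [Real.exp_neg, hℓdef, Real.exp_log (by positivity), inv_div]
  have hBℓ : B * ε ^ 2 = ℓ := by rw [hB]; field_simp
  have hB0 : 0 < B := by rw [hB]; positivity
  have hεB : 32 * ℓ ≤ ε * B := by
    have : 0 < ε * B := by positivity
    nlinarith
  have hB2 : 4 * ℓ ≤ B := by nlinarith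
  have hKℓ : 4096 * ℓ ≤ K := by rw [hK]; linarith
  have hK4 : (K : ℝ) ≤ 4 * B := by rw [hK]; nlinarith
  have hTne : T.Nonempty := by rw [← Finset.card_pos]; omega
  obtain ⟨t0, ht0, hmin⟩ := T.exists_min_image L.pi hTne
  set τ := L.pi t0 with hτ
  have hτ0 : 0 ≤ τ := hpi t0
  have hout : ∀ s ∉ T, L.pi s ≤ τ := fun s hs => hTtop t0 ht0 s hs
  obtain ⟨x, hx, hopt⟩ := aux_attain (L.zeroOn T) (fun i => (hb i).le)
  obtain ⟨hx01, hxA⟩ := hx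
  have hxA' : ∀ i, ∑ t, L.A t i * x t ≤ L.b i := hxA
  set V := (L.zeroOn T).opt with hV
  set z : Fin n → ℝ := fun t => (if t ∈ T then 0 else L.pi t) * x t with hz
  have hVz : V = ∑ t, z t := by
    rw [hopt]
    apply Finset.sum_congr rfl
    intro t _
    by_cases h : t ∈ T <;> simp [hz, PLP.zeroOn, h]
  have hz0 : ∀ t, 0 ≤ z t := by
    intro t
    simp only [hz]
    have := (hx01 t).1
    have := hpi t
    split_ifs <;> positivity
  have hzτ : ∀ t, z t ≤ τ := by
    intro t
    simp only [hz]
    obtain ⟨h0, h1⟩ := hx01 t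
    split_ifs with h
    · simpa using hτ0
    · have := hout t h
      nlinarith [hpi t]
  refine le_trans (by linarith : 1 - 6 * δ ≤ 1 - δ) ?_
  by_cases hcase : V ≤ K * τ
  · -- use the items of `T`
    set a : Fin n → ℝ := fun t => if t ∈ T then 1 else 0 with ha
    have ha01 : ∀ t, a t ∈ Set.Icc (0 : ℝ) 1 := by
      intro t; simp only [ha]; split_ifs <;> simp
    have hasum : ∑ t, a t = K := by simp [ha, hTcard]
    refine aux_frac (by omega) _ (fun I => ∑ t ∈ I, a t < 3 / 16 * ∑ t, a t)
      (fun (_ : Fin m) _ => False) δ ?_ ?_ ?_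
    · rw [← hexpℓ]
      exact aux_lower hq hnq a ha01 ℓ (by rw [hasum]; exact hKℓ) hℓ0.le
    · intro i
      simp only [Finset.filter_false, Finset.card_empty, Nat.cast_zero]
      positivity
    · intro I hI hQ _
      rw [not_lt, hasum] at hQ
      have h1 := aux_restrict hq hnq L hpi I hI a ha01 (by
        intro i
        calc ∑ t ∈ I, L.A t i * a t ≤ ∑ t ∈ I, a t := by
              apply Finset.sum_le_sum
              intro t _
              nlinarith [(hA t i).2, (ha01 t).1]
          _ ≤ ∑ t, a t := Finset.sum_le_sum_of_subset_of_nonneg (Finset.subset_univ _)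
              (fun t _ _ => (ha01 t).1)
          _ ≤ L.b i / 4 := by rw [hasum]; linarith [hwidth i])
      refine le_trans ?_ h1
      have h2 : τ * ∑ t ∈ I, a t ≤ ∑ t ∈ I, L.pi t * a t := by
        rw [Finset.mul_sum]
        apply Finset.sum_le_sum
        intro t _
        simp only [ha]
        split_ifs with h
        · simpa using hmin t h
        · simp
      have hK0 : (0 : ℝ) ≤ K := by positivity
      have h3 : τ * (3 / 16 * K) ≤ τ * ∑ t ∈ I, a t := by gcongr
      have : 0 ≤ K * τ := by positivity
      linarith
  · -- use the optimal solution
    push Not at hcase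
    have hτpos : 0 < τ := by
      rcases hτ0.lt_or_eq with h | h
      · exact h
      · exfalso
        rw [← h, mul_zero, hVz] at hcase
        have : ∑ t, z t ≤ 0 := Finset.sum_nonpos fun t _ => (hzτ t).trans h.symm.le
        linarith
    set a : Fin n → ℝ := fun t => z t / τ with ha
    have ha01 : ∀ t, a t ∈ Set.Icc (0 : ℝ) 1 := by
      intro t
      exact ⟨div_nonneg (hz0 t) hτ0, (div_le_one hτpos).2 (hzτ t)⟩
    have hasum : ∀ I : Finset (Fin n), ∑ t ∈ I, a t = (∑ t ∈ I, z t) / τ := by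
      intro I; simp only [ha, Finset.sum_div]
    have hM : (K : ℝ) ≤ ∑ t, a t := by
      rw [hasum, ← hVz, le_div_iff₀ hτpos]; exact hcase.le
    refine aux_frac (by omega) _ (fun I => ∑ t ∈ I, a t < 3 / 16 * ∑ t, a t)
      (fun i I => 3 / 8 * L.b i < ∑ t ∈ I, L.A t i * x t) δ ?_ ?_ ?_
    · rw [← hexpℓ]
      exact aux_lower hq hnq a ha01 ℓ (hKℓ.trans hM) hℓ0.le
    · intro i
      rw [← hexpℓ]
      refine aux_upper hq hnq (fun t => L.A t i * x t) ?_ ℓ (L.b i) (hxA' i)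
        (by linarith [hwidth i])
      intro t
      exact ⟨mul_nonneg (hA t i).1 (hx01 t).1,
        mul_le_one₀ (hA t i).2 (hx01 t).1 (hx01 t).2⟩
    · intro I hI hQ hR
      rw [not_lt, hasum, hasum, ← hVz, ← mul_div_assoc, div_le_div_iff_of_pos_right hτpos] at hQ
      have h1 := aux_restrict hq hnq L hpi I hI (fun t => 2 / 3 * x t)
        (fun t => ⟨by linarith [(hx01 t).1], by linarith [(hx01 t).2]⟩) (by
        intro i
        have := hR i
        rw [not_lt] at this
        have e : ∑ t ∈ I, L.A t i * (2 / 3 * x t) = 2 / 3 * ∑ t ∈ I, L.A t i * x t := by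
          rw [Finset.mul_sum]; exact Finset.sum_congr rfl fun t _ => by ring
        rw [e]; linarith)
      refine le_trans ?_ h1
      have h2 : 2 / 3 * ∑ t ∈ I, z t ≤ ∑ t ∈ I, L.pi t * (2 / 3 * x t) := by
        rw [Finset.mul_sum]
        apply Finset.sum_le_sum
        intro t _
        have := mul_nonneg (hpi t) (hx01 t).1
        simp only [hz]
        split_ifs <;> linarith
      linarith

end
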